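/- arXiv:2406.16558 — 2 statements merged into one kernel-verified Lean document; each statement's English description precedes it below -/
import Mathlib

section
/- Let n ≥ 2. Then every permutation σ ∈ S_n has 1 as an eigenvalue of the induced endomorphism ⋀^{n−2} ρ(σ) of ⋀^{n−2} V_n if and only if n is even. That is, the Specht module S^{(2,1^{n−2})} is unisingular if and only if n is even. -/
open Polynomial

noncomputable section

/-- The standard representation of `S_n`: the subspace `V_n` of `ℂ^n` of vectors with
coordinate sum zero (the Specht module `S^{(n-1,1)}`). -/
def Vn (n : ℕ) : Submodule ℂ (Fin n → ℂ) :=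
  LinearMap.ker (∑ i : Fin n, (LinearMap.proj i : (Fin n → ℂ) →ₗ[ℂ] ℂ))

/-- The endomorphism `ρ(σ)` of the standard representation induced by `v ↦ v ∘ σ⁻¹`. -/
def rho {n : ℕ} (σ : Equiv.Perm (Fin n)) : Vn n →ₗ[ℂ] Vn n :=
  (LinearMap.funLeft ℂ ℂ ⇑σ⁻¹).restrict (p := Vn n) (q := Vn n) fun v hv => by
    simp only [Vn, LinearMap.mem_ker, LinearMap.sum_apply, LinearMap.proj_apply,
      LinearMap.funLeft_apply] at hv ⊢
    rw [Equiv.sum_comp σ⁻¹ v]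
    exact hv

/-- The linear map functorially induced on the `k`-th exterior power `⋀[R]^k M`. -/
def extPowMap {R M : Type*} [CommRing R] [AddCommGroup M] [Module R M] (k : ℕ)
    (f : M →ₗ[R] M) : ⋀[R]^k M →ₗ[R] ⋀[R]^k M :=
  (ExteriorAlgebra.map f).toLinearMap.restrict (p := ⋀[R]^k M) (q := ⋀[R]^k M) fun x hx => by
    have h : Submodule.map (ExteriorAlgebra.map f).toLinearMap (⋀[R]^k M) ≤ ⋀[R]^k M := by
      rw [← ExteriorAlgebra.ιMulti_span_fixedDegree, Submodule.map_span, Submodule.span_le]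
      rintro y ⟨z, ⟨m, rfl⟩, rfl⟩
      exact Submodule.subset_span ⟨f ∘ m, (ExteriorAlgebra.map_apply_ιMulti f m).symm⟩
    exact h ⟨x, hx, rfl⟩

end

open Module

section ExteriorPower

lemma extPowMap_ιMulti {R M : Type*} [CommRing R] [AddCommGroup M] [Module R M] (k : ℕ)
    (f : M →ₗ[R] M) (m : Fin k → M) :
    extPowMap k f (exteriorPower.ιMulti R k m) = exteriorPower.ιMulti R k (f ∘ m) :=
  Subtype.ext (ExteriorAlgebra.map_apply_ιMulti f m)

variable {K V : Type*} [Field K] [AddCommGroup V] [Module K V] {d : ℕ}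

/-- The pairing `⋀^d V → V*` sending `x` to `v ↦ v ∧ x`, where `⋀^(d+1) V` is identified with
the base field through the determinant in a basis. -/
noncomputable def wedgeDual (b : Basis (Fin (d + 1)) K V) : ⋀[K]^d V →ₗ[K] Dual K V :=
  ((exteriorPower.alternatingMapLinearEquiv (R := K) (n := d) (M := V) (N := K)).toLinearMap ∘ₗ
    b.det.curryLeft).flip

lemma wedgeDual_ιMulti (b : Basis (Fin (d + 1)) K V) (m : Fin d → V) (v : V) :
    wedgeDual b (exteriorPower.ιMulti K d m) v = b.det (Fin.cons v m) := by
  simp [wedgeDual, LinearMap.flip_apply, Matrix.vecCons]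

lemma wedgeDual_extPowMap (b : Basis (Fin (d + 1)) K V) (f : V →ₗ[K] V) (x : ⋀[K]^d V) :
    wedgeDual b (extPowMap d f x) ∘ₗ f = LinearMap.det f • wedgeDual b x := by
  have h : (LinearMap.lcomp K K f) ∘ₗ wedgeDual b ∘ₗ extPowMap d f
      = LinearMap.det f • wedgeDual b := by
    refine exteriorPower.linearMap_ext (AlternatingMap.ext fun m => LinearMap.ext fun v => ?_)
    have hc : (Fin.cons (f v) (f ∘ m) : Fin (d + 1) → V) = f ∘ Fin.cons v m := by
      ext i
      refine Fin.cases ?_ (fun j => ?_) i <;> simp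
    simp [extPowMap_ιMulti, wedgeDual_ιMulti, hc, Basis.det_comp]
  exact LinearMap.congr_fun h x

lemma wedgeDual_surjective (b : Basis (Fin (d + 1)) K V) :
    Function.Surjective (wedgeDual b) := by
  rw [← LinearMap.range_eq_top, eq_top_iff, ← b.dualBasis.span_eq, Submodule.span_le]
  rintro _ ⟨i, rfl⟩
  have hne : b.det (Fin.cons (b i) (b ∘ i.succAbove)) ≠ 0 := by
    have hinj : Function.Bijective (Fin.cons i i.succAbove : Fin (d + 1) → Fin (d + 1)) :=
      Finite.injective_iff_bijective.mp (Fin.cons_injective_iff.mpr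
        ⟨by simp, Fin.succAbove_right_injective⟩)
    have hc : (Fin.cons (b i) (b ∘ i.succAbove) : Fin (d + 1) → V)
        = b ∘ Equiv.ofBijective _ hinj := by
      ext j
      refine Fin.cases ?_ (fun j => ?_) j <;> simp
    rw [hc, AlternatingMap.map_perm, b.det_self]
    rcases Int.units_eq_one_or (Equiv.Perm.sign (Equiv.ofBijective _ hinj)) with h | h <;> simp [h]
  refine ⟨(b.det (Fin.cons (b i) (b ∘ i.succAbove)))⁻¹ •
    exteriorPower.ιMulti K d (b ∘ i.succAbove), b.ext fun j => ?_⟩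
  rw [map_smul, LinearMap.smul_apply, wedgeDual_ιMulti, Basis.dualBasis_apply_self]
  rcases eq_or_ne j i with rfl | hj
  · simp [hne]
  · obtain ⟨k, rfl⟩ := Fin.exists_succAbove_eq hj
    have h0 : b.det (Fin.cons (b (i.succAbove k)) (b ∘ i.succAbove)) = 0 :=
      b.det.map_eq_zero_of_eq (i := k.succ) (j := 0) _ (by simp) (Fin.succ_ne_zero k)
    simp [h0, hj]

lemma wedgeDual_injective (b : Basis (Fin (d + 1)) K V) :
    Function.Injective (wedgeDual b) := by
  have := Module.Finite.of_basis b
  refine (LinearMap.injective_iff_surjective_of_finrank_eq_finrank ?_).mpr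
    (wedgeDual_surjective b)
  rw [exteriorPower.finrank_eq, Subspace.dual_finrank_eq, finrank_eq_card_basis b]
  simp

lemma hasEigenvalue_dualMap_iff [FiniteDimensional K V] (f : End K V) (μ : K) :
    End.HasEigenvalue (R := K) (M := Dual K V) f.dualMap μ ↔ f.HasEigenvalue μ := by
  have h : (f - μ • 1).dualMap = f.dualMap - μ • (1 : End K (Dual K V)) := by
    ext φ v
    simp
  rw [End.hasEigenvalue_iff, End.hasEigenvalue_iff, End.eigenspace_def, End.eigenspace_def,
    not_iff_not, ← h, LinearMap.ker_eq_bot, LinearMap.ker_eq_bot, LinearMap.dualMap_injective_iff,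
    LinearMap.injective_iff_surjective]

/-- On the exterior power of codegree one, `1` is an eigenvalue of the map induced by an
automorphism `f` if and only if `det f` is an eigenvalue of `f`. -/
lemma hasEigenvalue_extPowMap_one_iff (hV : finrank K V = d + 1) (f : End K V)
    (hf : Function.Surjective f) :
    End.HasEigenvalue (extPowMap d f) (1 : K) ↔ f.HasEigenvalue (LinearMap.det f) := by
  have : FiniteDimensional K V := Module.finite_of_finrank_eq_succ hV
  let b := Module.finBasisOfFinrankEq K V hV
  rw [← hasEigenvalue_dualMap_iff f]
  constructor
  · intro h
    obtain ⟨x, hx⟩ := h.exists_hasEigenvector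
    refine End.hasEigenvalue_of_hasEigenvector (x := wedgeDual b x)
      (End.hasEigenvector_iff.mpr ⟨End.mem_eigenspace_iff.mpr ?_, ?_⟩)
    · have := wedgeDual_extPowMap b f x
      rwa [hx.apply_eq_smul, one_smul] at this
    · exact (map_ne_zero_iff _ (wedgeDual_injective b)).mpr hx.2
  · intro h
    obtain ⟨φ, hφ⟩ := h.exists_hasEigenvector
    obtain ⟨x, rfl⟩ := wedgeDual_surjective b φ
    refine End.hasEigenvalue_of_hasEigenvector (x := x)
      (End.hasEigenvector_iff.mpr ⟨End.mem_eigenspace_iff.mpr ?_, ?_⟩)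
    · rw [one_smul]
      refine wedgeDual_injective b ((LinearMap.cancel_right hf).mp ?_)
      rw [wedgeDual_extPowMap]
      exact hφ.apply_eq_smul.symm
    · rintro rfl
      exact hφ.2 (map_zero _)

end ExteriorPower

section StandardRepresentation

variable {n : ℕ}

lemma mem_Vn {v : Fin n → ℂ} : v ∈ Vn n ↔ ∑ i, v i = 0 := by
  simp [Vn]

lemma coe_rho (σ : Equiv.Perm (Fin n)) (v : Vn n) :
    (rho σ v : Fin n → ℂ) = (v : Fin n → ℂ) ∘ ⇑σ⁻¹ := rfl

lemma rho_surjective (σ : Equiv.Perm (Fin n)) : Function.Surjective (rho σ) := by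
  refine fun v => ⟨rho σ⁻¹ v, Subtype.ext (funext fun i => ?_)⟩
  simp [coe_rho]

lemma finrank_Vn (d : ℕ) : finrank ℂ (Vn (d + 1)) = d := by
  have h : (∑ i : Fin (d + 1), (LinearMap.proj i : (Fin (d + 1) → ℂ) →ₗ[ℂ] ℂ)) ≠ 0 := by
    intro h
    simpa using LinearMap.congr_fun h (Pi.single 0 1)
  have := Dual.finrank_ker_add_one_of_ne_zero h
  rw [finrank_fin_fun] at this
  exact Nat.succ_injective this

lemma det_rho (σ : Equiv.Perm (Fin n)) :
    LinearMap.det (rho σ) = ((Equiv.Perm.sign σ : ℤ) : ℂ) := by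
  have he : Vn n ≤ (Vn n).comap (LinearMap.funLeft ℂ ℂ ⇑σ⁻¹) :=
    fun v hv => (rho σ ⟨v, hv⟩).2
  have hQ : (Vn n).mapQ (Vn n) (LinearMap.funLeft ℂ ℂ ⇑σ⁻¹) he = LinearMap.id := by
    refine Submodule.linearMap_qext _ (LinearMap.ext fun v => ?_)
    simp only [LinearMap.comp_apply, Submodule.mkQ_apply, Submodule.mapQ_apply, LinearMap.id_apply]
    rw [Submodule.Quotient.eq, mem_Vn]
    simp [LinearMap.funLeft_apply, Finset.sum_sub_distrib, Equiv.sum_comp σ.symm v]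
  have hP : LinearMap.funLeft ℂ ℂ ⇑σ⁻¹ = Matrix.toLin' (σ⁻¹.permMatrix ℂ) := by
    refine LinearMap.ext fun v => ?_
    rw [Matrix.toLin'_apply, Matrix.permMatrix_mulVec]
    rfl
  have h := LinearMap.det_eq_det_mul_det (Vn n) (LinearMap.funLeft ℂ ℂ ⇑σ⁻¹) he
  rw [hQ, LinearMap.det_id, mul_one] at h
  refine h.symm.trans ?_
  rw [hP, LinearMap.det_toLin', Matrix.det_permutation, Equiv.Perm.sign_inv]

lemma hasEigenvalue_rho_iff (σ : Equiv.Perm (Fin n)) (μ : ℂ) :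
    End.HasEigenvalue (rho σ) μ ↔
      ∃ v : Fin n → ℂ, v ≠ 0 ∧ ∑ i, v i = 0 ∧ ∀ i, v (σ⁻¹ i) = μ * v i := by
  constructor
  · intro h
    obtain ⟨v, hv⟩ := h.exists_hasEigenvector
    refine ⟨v, fun h0 => hv.2 (Subtype.ext h0), mem_Vn.mp v.2, fun i => ?_⟩
    exact congrFun (congrArg Subtype.val hv.apply_eq_smul) i
  · rintro ⟨v, h0, hs, hv⟩
    refine End.hasEigenvalue_of_hasEigenvector (x := (⟨v, mem_Vn.mpr hs⟩ : Vn n))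
      (End.hasEigenvector_iff.mpr ⟨End.mem_eigenspace_iff.mpr ?_, ?_⟩)
    · exact Subtype.ext (funext hv)
    · exact fun h => h0 (congrArg Subtype.val h)

lemma hasEigenvalue_rho_neg_one {σ : Equiv.Perm (Fin n)} (hσ : Equiv.Perm.sign σ = -1) :
    End.HasEigenvalue (rho σ) (-1) := by
  set P := σ⁻¹.permMatrix ℂ with hP
  have hPP : P * P.transpose = 1 := by
    rw [hP, Matrix.transpose_permMatrix, inv_inv, ← Matrix.permMatrix_mul]
    simp
  have hdet : (1 + P).det = 0 := by
    have h : 1 + P = P * (1 + P).transpose := by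
      rw [Matrix.transpose_add, Matrix.transpose_one, mul_add, hPP, mul_one, add_comm]
    have h' := congrArg Matrix.det h
    rw [Matrix.det_mul, Matrix.det_transpose, hP, Matrix.det_permutation, Equiv.Perm.sign_inv,
      hσ] at h'
    push_cast at h'
    linear_combination h' / 2
  obtain ⟨v, h0, hv⟩ := Matrix.exists_mulVec_eq_zero_iff.mpr hdet
  have hv' (i : Fin n) : v (σ⁻¹ i) = -1 * v i := by
    rw [Matrix.add_mulVec, Matrix.one_mulVec, hP, Matrix.permMatrix_mulVec] at hv
    have := congrFun hv i
    simp only [Pi.add_apply, Function.comp_apply, Pi.zero_apply] at this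
    linear_combination this
  refine (hasEigenvalue_rho_iff σ _).mpr ⟨v, h0, ?_, hv'⟩
  have hs := Equiv.sum_comp σ⁻¹ v
  simp only [hv', ← Finset.mul_sum] at hs
  linear_combination -hs / 2

lemma hasEigenvalue_rho_one_of_not_sameCycle {σ : Equiv.Perm (Fin n)} {a b : Fin n}
    (hab : ¬ σ.SameCycle a b) : End.HasEigenvalue (rho σ) 1 := by
  classical
  let w : Fin n → ℂ := fun i => if σ.SameCycle a i then 1 else 0
  have hn : (n : ℂ) ≠ 0 := Nat.cast_ne_zero.mpr a.pos.ne'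
  refine (hasEigenvalue_rho_iff σ 1).mpr ⟨fun i => w i - (∑ j, w j) / n, fun h => ?_, ?_, ?_⟩
  · have ha := congrFun h a
    have hb := congrFun h b
    simp only [w, hab, Equiv.Perm.SameCycle.refl, if_true, if_false, Pi.zero_apply] at ha hb
    exact one_ne_zero (α := ℂ) (by linear_combination ha - hb)
  · simp [Finset.sum_sub_distrib, mul_div_cancel₀ _ hn]
  · intro i
    simp [w]

lemma exists_not_sameCycle {σ : Equiv.Perm (Fin n)} (hn : 2 ≤ n) (he : Even n)
    (hσ : Equiv.Perm.sign σ = 1) : ∃ a b, ¬ σ.SameCycle a b := by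
  by_contra! h
  let a : Fin n := ⟨0, by omega⟩
  have hmove (x : Fin n) : σ x ≠ x := by
    intro hx
    obtain ⟨y, hy⟩ : ∃ y, y ≠ x := by
      have : Nontrivial (Fin n) := Fin.nontrivial_iff_two_le.mpr hn
      exact exists_ne x
    exact hy ((h x y).eq_of_left hx).symm
  have hc : σ.IsCycle := ⟨a, hmove a, fun y _ => h a y⟩
  have hsupp : σ.support = Finset.univ := by
    ext x
    simp [hmove x]
  have hs := hc.sign
  rw [hσ, hsupp, Finset.card_univ, Fintype.card_fin, he.neg_one_pow] at hs
  exact absurd hs (by decide)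

lemma not_hasEigenvalue_rho_finRotate_one (d : ℕ) :
    ¬ End.HasEigenvalue (rho (finRotate (d + 2))) 1 := by
  intro h
  obtain ⟨v, h0, hs, hv⟩ := (hasEigenvalue_rho_iff _ _).mp h
  have hv' (i : Fin (d + 2)) : v (i + 1) = v i := by
    have := hv (finRotate _ i)
    rw [Equiv.Perm.inv_def, Equiv.symm_apply_apply, one_mul, finRotate_apply] at this
    exact this.symm
  have hconst (i : Fin (d + 2)) : v i = v 0 := by
    induction i using Fin.induction with
    | zero => rfl
    | succ i ih => rw [← ih, ← hv' i.castSucc, Fin.coeSucc_eq_succ]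
  have h00 : v 0 = 0 := by
    simp only [hconst, Finset.sum_const, Finset.card_univ, Fintype.card_fin, nsmul_eq_mul] at hs
    exact (mul_eq_zero.mp hs).resolve_left (Nat.cast_ne_zero.mpr (by omega))
  exact h0 (funext fun i => (hconst i).trans h00)

end StandardRepresentation

/-- For `n ≥ 2`, every `σ ∈ S_n` has `1` as an eigenvalue on `⋀^{n-2} V_n` if and only if
`n` is even; i.e. the Specht module `S^{(2,1^{n-2})}` is unisingular iff `n` is even. -/
theorem specht_two_one_unisingular_iff (n : ℕ) (hn : 2 ≤ n) :
    (∀ σ : Equiv.Perm (Fin n),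
      Module.End.HasEigenvalue (extPowMap (n - 2) (rho σ)) (1 : ℂ)) ↔ Even n := by
  obtain ⟨d, rfl⟩ := Nat.exists_eq_add_of_le' hn
  have key (σ : Equiv.Perm (Fin (d + 2))) :
      Module.End.HasEigenvalue (extPowMap (d + 2 - 2) (rho σ)) (1 : ℂ) ↔
        Module.End.HasEigenvalue (rho σ) ((Equiv.Perm.sign σ : ℤ) : ℂ) := by
    rw [← det_rho]
    exact hasEigenvalue_extPowMap_one_iff (finrank_Vn (d + 1)) _ (rho_surjective σ)
  simp only [key]
  constructor
  · intro h
    by_contra hodd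
    refine not_hasEigenvalue_rho_finRotate_one d ?_
    have hd : Even (d + 1) := by
      rw [Nat.even_add_one] at hodd
      exact not_not.mp hodd
    simpa [sign_finRotate, hd.neg_one_pow] using h (finRotate (d + 2))
  · intro he σ
    rcases Int.units_eq_one_or (Equiv.Perm.sign σ) with hσ | hσ
    · obtain ⟨a, b, hab⟩ := exists_not_sameCycle hn he hσ
      simpa [hσ] using hasEigenvalue_rho_one_of_not_sameCycle hab
    · simpa [hσ] using hasEigenvalue_rho_neg_one hσ
end

section
/- Let n ≥ 2 and let σ ∈ S_n be an odd permutation (sign σ = −1). Then the multiplicity of −1 as a root of the characteristic polynomial of the endomorphism −ρ(σ) of V_n (the action of σ on S^{(n−1,1)} ⊗ sgn) equals r(σ) − 1, where r(σ) = (cycleType σ).card + (n − (cycleType σ).sum) is the number of cycles of σ counting fixed points. -/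
open Polynomial

namespace Equiv.Perm

variable {α : Type*} [Fintype α] [DecidableEq α]

/-- The cycle of `σ` through `x`: a nontrivial cycle factor, or `x` itself if `σ` fixes `x`. -/
def cycleIndex (σ : Perm α) (x : α) :
    σ.cycleFactorsFinset ⊕ Function.fixedPoints σ :=
  if h : σ x = x then .inr ⟨x, h⟩
  else .inl ⟨σ.cycleOf x, cycleOf_mem_cycleFactorsFinset_iff.mpr (mem_support.mpr h)⟩

theorem cycleIndex_surjective (σ : Perm α) : Function.Surjective σ.cycleIndex := by
  rintro (⟨c, hc⟩ | ⟨x, hx⟩)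
  · obtain ⟨x, hx⟩ := (mem_cycleFactorsFinset_iff.mp hc).1.nonempty_support
    have hσx : σ x ≠ x := mem_support.mp (mem_cycleFactorsFinset_support_le hc hx)
    refine ⟨x, ?_⟩
    simp only [cycleIndex, hσx, dite_false]
    exact congrArg Sum.inl (Subtype.ext (cycle_is_cycleOf hx hc).symm)
  · refine ⟨x, ?_⟩
    have hσx : σ x = x := hx
    simp [cycleIndex, hσx]

theorem cycleIndex_apply (σ : Perm α) (x : α) : σ.cycleIndex (σ x) = σ.cycleIndex x := by
  by_cases h : σ x = x
  · rw [h]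
  · have h' : σ (σ x) ≠ σ x := fun e => h (σ.injective e)
    simp only [cycleIndex, h, h', dite_false]
    exact congrArg Sum.inl (Subtype.ext (sameCycle_apply_left.mpr (SameCycle.refl σ x)).cycleOf_eq)

theorem sameCycle_of_cycleIndex_eq {σ : Perm α} {x y : α}
    (h : σ.cycleIndex x = σ.cycleIndex y) : σ.SameCycle x y := by
  by_cases hx : σ x = x <;> by_cases hy : σ y = y <;>
    simp only [cycleIndex, hx, hy, dite_true, dite_false, Sum.inl.injEq, Sum.inr.injEq,
      Subtype.mk.injEq, reduceCtorEq] at h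
  · have hxy : x = y := congrArg Subtype.val h
    exact hxy ▸ SameCycle.refl σ x
  · exact (sameCycle_iff_cycleOf_eq_of_mem_support (mem_support.mpr hx)
      (mem_support.mpr hy)).mpr h

theorem card_cycleFactorsFinset_sum_fixedPoints (σ : Perm α) :
    Fintype.card (σ.cycleFactorsFinset ⊕ Function.fixedPoints σ) =
      σ.cycleType.card + (Fintype.card α - σ.cycleType.sum) := by
  rw [Fintype.card_sum, card_fixedPoints, Fintype.card_coe, cycleType_def, Multiset.card_map]
  rfl

theorem apply_eq_of_sameCycle {β : Type*} {σ : Perm α} {v : α → β} (hv : ∀ x, v (σ x) = v x)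
    {x y : α} (h : σ.SameCycle x y) : v x = v y := by
  obtain ⟨k, -, -, rfl⟩ := h.exists_pow_eq
  induction k with
  | zero => rfl
  | succ k ih => rw [pow_succ', mul_apply, hv]; exact ih ⟨k, by simp⟩

theorem mem_range_funLeft_cycleIndex (R : Type*) [Semiring R] (σ : Perm α) (v : α → R) :
    v ∈ LinearMap.range (LinearMap.funLeft R R σ.cycleIndex) ↔ ∀ x, v (σ x) = v x := by
  constructor
  · rintro ⟨w, rfl⟩ x
    simp [LinearMap.funLeft_apply, cycleIndex_apply]
  · intro hv
    refine ⟨fun b => v (Function.surjInv σ.cycleIndex_surjective b), funext fun x => ?_⟩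
    exact apply_eq_of_sameCycle hv
      (sameCycle_of_cycleIndex_eq (Function.surjInv_eq σ.cycleIndex_surjective _))

end Equiv.Perm

theorem Module.End.isSemisimple_of_pow_eq_one {K M : Type*} [Field K] [CharZero K]
    [AddCommGroup M] [Module K M] {f : Module.End K M} {k : ℕ} (hk : k ≠ 0) (h : f ^ k = 1) :
    f.IsSemisimple :=
  isSemisimple_of_squarefree_aeval_eq_zero
    (X_pow_sub_one_separable_iff.mpr (Nat.cast_ne_zero.mpr hk)).squarefree
    (by simp [h])

theorem coe_rho_apply {n : ℕ} (σ : Equiv.Perm (Fin n)) (v : Vn n) (i : Fin n) :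
    (rho σ v : Fin n → ℂ) i = (v : Fin n → ℂ) (σ⁻¹ i) := rfl

theorem rho_one {n : ℕ} : rho (1 : Equiv.Perm (Fin n)) = 1 := by
  ext v i
  simp [coe_rho_apply]

theorem rho_mul {n : ℕ} (σ τ : Equiv.Perm (Fin n)) : rho (σ * τ) = rho σ * rho τ := by
  ext v i
  simp [coe_rho_apply]

theorem rho_pow {n : ℕ} (σ : Equiv.Perm (Fin n)) (k : ℕ) :
    rho (σ ^ k) = (rho σ : Module.End ℂ (Vn n)) ^ k := by
  induction k with
  | zero => simp [rho_one]
  | succ k ih => rw [pow_succ, rho_mul, ih, pow_succ]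

theorem isSemisimple_neg_rho {n : ℕ} (σ : Equiv.Perm (Fin n)) :
    Module.End.IsSemisimple (-(rho σ)) := by
  refine Module.End.isSemisimple_neg.mpr
    (Module.End.isSemisimple_of_pow_eq_one (orderOf_pos σ).ne' ?_)
  rw [← rho_pow, pow_orderOf_eq_one, rho_one]

theorem mem_eigenspace_neg_rho_iff {n : ℕ} {σ : Equiv.Perm (Fin n)} {v : Vn n} :
    v ∈ Module.End.eigenspace (-(rho σ)) (-1) ↔
      ∀ i, (v : Fin n → ℂ) (σ i) = (v : Fin n → ℂ) i := by
  rw [Module.End.mem_eigenspace_iff, LinearMap.neg_apply, neg_one_smul, neg_inj, Subtype.ext_iff,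
    funext_iff, ← σ.forall_congr_right]
  simp only [coe_rho_apply, Equiv.Perm.coe_inv, Equiv.symm_apply_apply]
  exact forall_congr' fun _ => eq_comm

theorem finrank_eigenspace_neg_rho {n : ℕ} (hn : n ≠ 0) (σ : Equiv.Perm (Fin n)) :
    Module.finrank ℂ (Module.End.eigenspace (-(rho σ)) (-1)) + 1 =
      σ.cycleType.card + (n - σ.cycleType.sum) := by
  let L := LinearMap.funLeft ℂ ℂ σ.cycleIndex
  let φ : Module.Dual ℂ (Fin n → ℂ) := ∑ i : Fin n, LinearMap.proj i
  have hL : Function.Injective L :=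
    LinearMap.funLeft_injective_of_surjective ℂ ℂ _ σ.cycleIndex_surjective
  have hmap : (Module.End.eigenspace (-(rho σ)) (-1)).map (Vn n).subtype =
      (LinearMap.ker (φ ∘ₗ L)).map L := by
    ext v
    constructor
    · rintro ⟨v, hv, rfl⟩
      obtain ⟨w, hw⟩ := (σ.mem_range_funLeft_cycleIndex ℂ v).mpr
        (mem_eigenspace_neg_rho_iff.mp hv)
      refine ⟨w, ?_, hw⟩
      change φ (L w) = 0
      rw [show L w = v from hw]
      exact v.2
    · rintro ⟨w, hw, rfl⟩
      exact ⟨⟨L w, hw⟩, mem_eigenspace_neg_rho_iff.mpr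
        ((σ.mem_range_funLeft_cycleIndex ℂ (L w)).mp ⟨w, rfl⟩), rfl⟩
  have hφ : φ ∘ₗ L ≠ 0 := fun h => by
    have h1 := LinearMap.congr_fun h 1
    simp [φ, L, LinearMap.funLeft_apply, hn] at h1
  have e₁ := (Submodule.equivMapOfInjective _ (Vn n).injective_subtype
    (Module.End.eigenspace (-(rho σ)) (-1))).finrank_eq
  have e₂ := (Submodule.equivMapOfInjective L hL (LinearMap.ker (φ ∘ₗ L))).finrank_eq
  rw [e₁, hmap, ← e₂, Module.Dual.finrank_ker_add_one_of_ne_zero hφ,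
    Module.finrank_fintype_fun_eq_card, σ.card_cycleFactorsFinset_sum_fixedPoints, Fintype.card_fin]

/-- For `n ≥ 2` and `σ ∈ S_n` odd, the multiplicity of `-1` as a root of the characteristic
polynomial of `-ρ(σ)` (the action of `σ` on `S^{(n-1,1)} ⊗ sgn`) is `r(σ) - 1`, where
`r(σ) = (cycleType σ).card + (n - (cycleType σ).sum)`. -/
theorem rootMultiplicity_neg_one_sgn_twist (n : ℕ) (hn : 2 ≤ n) (σ : Equiv.Perm (Fin n))
    (hσ : Equiv.Perm.sign σ = -1) :
    (LinearMap.charpoly (-(rho σ))).rootMultiplicity (-1) =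
      (σ.cycleType.card + (n - σ.cycleType.sum)) - 1 := by
  rw [← LinearMap.finrank_maxGenEigenspace_eq,
    (isSemisimple_neg_rho σ).isFinitelySemisimple.maxGenEigenspace_eq_eigenspace,
    ← finrank_eigenspace_neg_rho (by omega) σ, Nat.add_sub_cancel]
end
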